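/- arXiv:2510.00016 — 2 statements merged into one kernel-verified Lean document; each statement's English description precedes it below -/
import Mathlib

section
/- (Pentagon relation for the infinitesimal dilogarithm ℓi_{2,3}.) Let k be a field of characteristic 0 and k₂ = k[t]/(t²). For all x, y ∈ k₂^♭ such that y − x is a unit of k₂ (which guarantees that y/x, (1−x⁻¹)/(1−y⁻¹) and (1−x)/(1−y) all lie in k₂^♭), one has L(x) − L(y) + L(y/x) − L((1−x⁻¹)/(1−y⁻¹)) + L((1−x)/(1−y)) = 0. -/
open TrivSqZeroExt

/-- The infinitesimal dilogarithm of modulus 2 and weight 3 on the dual numbers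
`k₂ = k[t]/(t²)`: `L(s + ut) = −u³/(2s²(s−1)²)`. -/
noncomputable def li23 {k : Type*} [Field k] (x : DualNumber k) : k :=
  -x.snd ^ 3 / (2 * x.fst ^ 2 * (x.fst - 1) ^ 2)

/-- `x = s + ut ∈ k₂` lies in `k₂^♭` iff `s(1−s) ≠ 0`. -/
def IsFlat {k : Type*} [Field k] (x : DualNumber k) : Prop :=
  x.fst * (1 - x.fst) ≠ 0

/-- The value of `li23` on a quotient of dual numbers with invertible denominator. -/
theorem li23_mul_inv {k : Type*} [Field k] (x y : DualNumber k) (hy : y.fst ≠ 0) :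
    li23 (x * y⁻¹) = -(x.snd * y.fst - x.fst * y.snd) ^ 3 /
      (2 * x.fst ^ 2 * y.fst ^ 2 * (x.fst - y.fst) ^ 2) := by
  have hfst : x.fst * y.fst⁻¹ - 1 = (x.fst - y.fst) / y.fst := by field_simp
  have hsnd : (x * y⁻¹).snd = (x.snd * y.fst - x.fst * y.snd) / y.fst ^ 2 := by
    simp only [snd_mul, fst_inv, snd_inv, smul_eq_mul, MulOpposite.smul_eq_mul_unop,
      MulOpposite.unop_op]
    field_simp
    ring
  rw [li23, hsnd, fst_mul, fst_inv, hfst]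
  field_simp

/-- The constant term of `1 - x⁻¹`. -/
theorem fst_one_sub_inv {k : Type*} [Field k] (x : DualNumber k) (hx : x.fst ≠ 0) :
    (1 - x⁻¹).fst = -(1 - x.fst) / x.fst := by
  rw [fst_sub, fst_one, fst_inv]
  field_simp
  ring

/-- The infinitesimal part of `1 - x⁻¹`. -/
theorem snd_one_sub_inv {k : Type*} [Field k] (x : DualNumber k) (hx : x.fst ≠ 0) :
    (1 - x⁻¹).snd = x.snd / x.fst ^ 2 := by
  simp only [snd_sub, snd_one, snd_inv, smul_eq_mul, MulOpposite.smul_eq_mul_unop,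
    MulOpposite.unop_op]
  field_simp
  ring

/-- The pentagon relation for the infinitesimal dilogarithm `ℓi_{2,3}`. -/
theorem li23_pentagon (k : Type*) [Field k] [CharZero k] (x y : DualNumber k)
    (hx : IsFlat x) (hy : IsFlat y) (hxy : IsUnit (y - x)) :
    li23 x - li23 y + li23 (y * x⁻¹)
      - li23 ((1 - x⁻¹) * (1 - y⁻¹)⁻¹) + li23 ((1 - x) * (1 - y)⁻¹) = 0 := by
  have ha : x.fst ≠ 0 := left_ne_zero_of_mul hx
  have ha' : 1 - x.fst ≠ 0 := right_ne_zero_of_mul hx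
  have hb : y.fst ≠ 0 := left_ne_zero_of_mul hy
  have hb' : 1 - y.fst ≠ 0 := right_ne_zero_of_mul hy
  have hab : y.fst - x.fst ≠ 0 := by
    simpa using (TrivSqZeroExt.isUnit_iff_isUnit_fst.mp hxy).ne_zero
  have hc : (1 - y⁻¹).fst ≠ 0 := by
    rw [fst_one_sub_inv y hb]
    exact div_ne_zero (neg_ne_zero.mpr hb') hb
  rw [li23_mul_inv y x ha, li23_mul_inv _ _ hc, li23_mul_inv (1 - x) (1 - y) (by simpa using hb'),
    fst_one_sub_inv x ha, fst_one_sub_inv y hb, snd_one_sub_inv x ha, snd_one_sub_inv y hb]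
  simp only [li23, fst_sub, snd_sub, fst_one, snd_one]
  generalize x.fst = a at *
  generalize y.fst = b at *
  generalize x.snd = p
  generalize y.snd = q
  have hdiff : -(1 - a) / a - -(1 - b) / b = (a - b) / (a * b) := by
    field_simp
    ring
  have hdiff' : 1 - a - (1 - b) = b - a := by ring
  rw [hdiff, hdiff', ← neg_sub 1 a, ← neg_sub 1 b, ← neg_sub b a]
  field_simp
  ring
end

section
/- (Instance of the infinitesimal reduction theorem.) Let k be a field of characteristic 0 and k₂ = k[t]/(t²). Let f : k₂^♭ → k be a function such that: (i) f(s) = 0 for every constant element s ∈ k ⊂ k₂ with s(1−s) ≠ 0; and (ii) f satisfies the pentagon relation, i.e. f(x) − f(y) + f(y/x) − f((1−x⁻¹)/(1−y⁻¹)) + f((1−x)/(1−y)) = 0 for all x, y ∈ k₂^♭ with y − x a unit of k₂. Then f satisfies the basic cluster relation: f(y⁻¹) + f(y) = 0 for every y ∈ k₂^♭ (note y is then a unit and y⁻¹ ∈ k₂^♭ automatically). -/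
open TrivSqZeroExt

theorem isFlat_iff {k : Type*} [Field k] (x : DualNumber k) :
    IsFlat x ↔ x.fst ≠ 0 ∧ x.fst ≠ 1 := by
  rw [IsFlat, mul_ne_zero_iff, sub_ne_zero, ne_comm (a := (1 : k))]

theorem DualNumber.mul_inv_eq_of_eq_mul {k : Type*} [Field k] {a b c : DualNumber k}
    (hc : c.fst ≠ 0) (h : a = b * c) : a * c⁻¹ = b := by
  rw [h, mul_assoc, TrivSqZeroExt.mul_inv_cancel hc, mul_one]

/-- Comparing the pentagon relation at `(x, y)` and at `(y, x)` shows that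
`z ↦ f z⁻¹ + f z` turns products into sums. -/
theorem pentagon_symmetrization_mul {k : Type*} [Field k] (f : DualNumber k → k)
    (hpent : ∀ x y : DualNumber k, IsFlat x → IsFlat y → IsUnit (y - x) →
      f x - f y + f (y * x⁻¹)
        - f ((1 - x⁻¹) * (1 - y⁻¹)⁻¹) + f ((1 - x) * (1 - y)⁻¹) = 0)
    {b c : DualNumber k} (hb : IsFlat b) (hc : IsFlat c) (hbc : IsFlat (b * c)) :
    f (b * c)⁻¹ + f (b * c) = (f b⁻¹ + f b) + (f c⁻¹ + f c) := by
  rw [isFlat_iff] at hb hc hbc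
  obtain ⟨hb0, hb1⟩ := hb
  obtain ⟨hc0, hc1⟩ := hc
  obtain ⟨hbc0, hbc1⟩ := hbc
  have hd : (b * c - 1).fst ≠ 0 := by simpa [sub_ne_zero] using hbc1
  obtain ⟨x, hx⟩ : ∃ x, x = (b - 1) * (b * c - 1)⁻¹ := ⟨_, rfl⟩
  have hxd : x * (b * c - 1) = b - 1 := by
    rw [hx, mul_assoc, TrivSqZeroExt.inv_mul_cancel hd, mul_one]
  have hxd' : x.fst * (b.fst * c.fst - 1) = b.fst - 1 := by
    simpa using congrArg TrivSqZeroExt.fst hxd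
  have hx0 : x.fst ≠ 0 := by
    intro h
    rw [h, zero_mul] at hxd'
    exact hb1 (sub_eq_zero.mp hxd'.symm)
  have hx1 : x.fst ≠ 1 := by
    intro h
    rw [h, one_mul] at hxd'
    exact hc1 (mul_left_cancel₀ hb0 (by linear_combination hxd'))
  obtain ⟨y, hy⟩ : ∃ y, y = c * x := ⟨_, rfl⟩
  have hy' : y.fst = c.fst * x.fst := by simp [hy]
  have hy0 : y.fst ≠ 0 := hy' ▸ mul_ne_zero hc0 hx0
  have hy1 : y.fst ≠ 1 := by
    intro h
    exact hx1 (by linear_combination b.fst * h - hxd' - b.fst * hy')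
  have hX := TrivSqZeroExt.mul_inv_cancel hx0
  have hY := TrivSqZeroExt.mul_inv_cancel hy0
  have hyx : (y - x).fst ≠ 0 := by
    rw [fst_sub, hy', sub_ne_zero]
    intro h
    exact hc1 (mul_right_cancel₀ hx0 (by rw [h, one_mul]))
  have hxu : IsUnit (y - x) := isUnit_iff_isUnit_fst.mpr hyx.isUnit
  have hyu : IsUnit (x - y) := by simpa using hxu.neg
  have eb : (1 - x) = b * (1 - y) := by rw [hy]; linear_combination hxd
  have ebc : (1 - x⁻¹) = b * c * (1 - y⁻¹) := by
    have hcy : c * y⁻¹ = x⁻¹ := by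
      linear_combination x⁻¹ * hY - c * y⁻¹ * hX - x⁻¹ * y⁻¹ * hy
    linear_combination -x⁻¹ * hxd + (b * c - 1) * hX + b * hcy
  have h1y : (1 - y).fst ≠ 0 := by simpa [sub_ne_zero] using hy1.symm
  have h1y' : (1 - y⁻¹).fst ≠ 0 := by
    rw [fst_sub, fst_one, fst_inv, sub_ne_zero]
    exact (inv_ne_one.mpr hy1).symm
  have e1 : y * x⁻¹ = c := DualNumber.mul_inv_eq_of_eq_mul hx0 hy
  have e2 := DualNumber.mul_inv_eq_of_eq_mul h1y eb
  have e3 := DualNumber.mul_inv_eq_of_eq_mul h1y' ebc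
  have e1' : x * y⁻¹ = c⁻¹ := by
    rw [← e1, TrivSqZeroExt.mul_inv_rev, TrivSqZeroExt.inv_inv hx0]
  have e2' : (1 - y) * (1 - x)⁻¹ = b⁻¹ := by
    rw [← e2, TrivSqZeroExt.mul_inv_rev, TrivSqZeroExt.inv_inv h1y]
  have e3' : (1 - y⁻¹) * (1 - x⁻¹)⁻¹ = (b * c)⁻¹ := by
    rw [← e3, TrivSqZeroExt.mul_inv_rev, TrivSqZeroExt.inv_inv h1y']
  have hfx := (isFlat_iff x).mpr ⟨hx0, hx1⟩
  have hfy := (isFlat_iff y).mpr ⟨hy0, hy1⟩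
  have p := hpent x y hfx hfy hxu
  have q := hpent y x hfy hfx hyu
  rw [e1, e2, e3] at p
  rw [e1', e2', e3'] at q
  linear_combination -p - q

/-- Instance of the infinitesimal reduction theorem: any function on `k₂^♭` that vanishes on
constant elements and satisfies the pentagon relation also satisfies the basic cluster relation
`f(y⁻¹) + f(y) = 0`. -/
theorem infinitesimal_reduction_basic (k : Type*) [Field k] [CharZero k]
    (f : DualNumber k → k)
    (h0 : ∀ s : k, s * (1 - s) ≠ 0 → f (inl s) = 0)
    (hpent : ∀ x y : DualNumber k, IsFlat x → IsFlat y → IsUnit (y - x) →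
      f x - f y + f (y * x⁻¹)
        - f ((1 - x⁻¹) * (1 - y⁻¹)⁻¹) + f ((1 - x) * (1 - y)⁻¹) = 0) :
    ∀ y : DualNumber k, IsFlat y → f y⁻¹ + f y = 0 := by
  intro b hb
  obtain ⟨hb0, hb1⟩ := (isFlat_iff b).mp hb
  obtain ⟨s, hs0, hs1, hbs⟩ : ∃ s : k, s ≠ 0 ∧ s ≠ 1 ∧ b.fst * s ≠ 1 := by
    by_cases h : b.fst * 2 = 1
    · refine ⟨3, by norm_num, by norm_num, fun h3 => hb0 ?_⟩
      linear_combination h3 - h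
    · exact ⟨2, by norm_num, by norm_num, h⟩
  have hc : IsFlat (inl s : DualNumber k) := (isFlat_iff _).mpr (by simpa using ⟨hs0, hs1⟩)
  have hbc : IsFlat (b * inl s) :=
    (isFlat_iff _).mpr ⟨by simpa using ⟨hb0, hs0⟩, by simpa using hbs⟩
  have hb' : IsFlat b⁻¹ := (isFlat_iff _).mpr ⟨by simpa using hb0, by simpa using hb1⟩
  have hcancel : b⁻¹ * (b * inl s) = inl s := by
    rw [← mul_assoc, TrivSqZeroExt.inv_mul_cancel hb0, one_mul]
  have p := pentagon_symmetrization_mul f hpent hb hc hbc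
  have q := pentagon_symmetrization_mul f hpent hb' hbc (hcancel.symm ▸ hc)
  rw [hcancel, TrivSqZeroExt.inv_inv hb0] at q
  have h2 : (2 : k) * (f b⁻¹ + f b) = 0 := by linear_combination -p - q
  exact (mul_eq_zero.mp h2).resolve_left two_ne_zero
end
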